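/- arXiv:1511.02704 — 5 statements merged into one kernel-verified Lean document; each statement's English description precedes it below -/
import Mathlib

section
/- Let d ≥ 1 and suppose the d-periodic function c : ℤ → ℂ satisfies the unitarity condition and the Yang–Baxter condition. Then for every φ ∈ ℝ, each of the following d-periodic functions also satisfies both conditions: n ↦ e^{iφ}·c(n); n ↦ ω^n·c(n); and n ↦ conj(c(−n)). -/
open Complex

/-- ω = exp(2πi/d). -/
noncomputable def omegaC (d : ℕ) : ℂ := Complex.exp (2 * Real.pi * Complex.I / d)

/-- A function `c : ℤ → ℂ` is `d`-periodic. -/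
def IsPeriodic (d : ℕ) (c : ℤ → ℂ) : Prop := ∀ m : ℤ, c (m + d) = c m

/-- The unitarity condition: for every `r`, `∑_{m=0}^{d-1} c(m) conj(c(m+r))` equals `d`
if `d ∣ r` and `0` otherwise. -/
def UnitarityCond (d : ℕ) (c : ℤ → ℂ) : Prop :=
  ∀ r : ℤ, ∑ m ∈ Finset.range d, c m * (starRingEnd ℂ) (c (m + r)) =
    if (d : ℤ) ∣ r then (d : ℂ) else 0

/-- The Yang–Baxter condition. -/
def YangBaxterCond (d : ℕ) (c : ℤ → ℂ) : Prop :=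
  ∀ k m : ℤ, ∑ r ∈ Finset.range d, c r * c (k - r) * c m * omegaC d ^ (m * r) =
    ∑ r ∈ Finset.range d, c r * c k * c (m - r) * omegaC d ^ (k * r)

lemma sum_shift_one (d : ℕ) (f : ℤ → ℂ) (hf : IsPeriodic d f) :
    ∑ m ∈ Finset.range d, f (m + 1) = ∑ m ∈ Finset.range d, f m := by
  have h1 := Finset.sum_range_succ (fun m : ℕ => f m) d
  have h2 := Finset.sum_range_succ' (fun m : ℕ => f m) d
  have h3 := hf 0
  rw [zero_add] at h3
  push_cast at h1 h2
  rw [h1, h3] at h2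
  exact (add_right_cancel h2).symm

lemma sum_shift (d : ℕ) (f : ℤ → ℂ) (hf : IsPeriodic d f) (k : ℤ) :
    ∑ m ∈ Finset.range d, f (m + k) = ∑ m ∈ Finset.range d, f m := by
  have step : ∀ j : ℤ, ∑ m ∈ Finset.range d, f (m + (j + 1)) =
      ∑ m ∈ Finset.range d, f (m + j) := by
    intro j
    have := sum_shift_one d (fun n => f (n + j)) (fun n => by
      show f (n + d + j) = f (n + j)
      rw [add_right_comm, hf])
    rw [← this]
    refine Finset.sum_congr rfl fun m _ => ?_
    congr 1
    ring
  induction k using Int.induction_on with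
  | zero => simp
  | succ i ih => rw [step, ih]
  | pred i ih => rw [← ih, ← step, sub_add_cancel]

lemma sum_neg' (d : ℕ) (f : ℤ → ℂ) (hf : IsPeriodic d f) :
    ∑ m ∈ Finset.range d, f (-m) = ∑ m ∈ Finset.range d, f m := by
  rw [← Finset.sum_range_reflect, ← sum_shift d f hf (1 - d)]
  refine Finset.sum_congr rfl fun m hm => ?_
  have : m < d := Finset.mem_range.mp hm
  congr 1
  omega

lemma omega_ne (d : ℕ) : omegaC d ≠ 0 := Complex.exp_ne_zero _

lemma omega_pow (d : ℕ) (hd : 1 ≤ d) : omegaC d ^ (d : ℤ) = 1 := by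
  rw [zpow_natCast]
  exact (Complex.isPrimitiveRoot_exp d (by omega)).pow_eq_one

lemma omega_conj (d : ℕ) : (starRingEnd ℂ) (omegaC d) = (omegaC d)⁻¹ := by
  rw [omegaC, ← Complex.exp_conj, ← Complex.exp_neg]
  congr 1
  have h2 : (starRingEnd ℂ) 2 = 2 := Complex.conj_ofNat 2
  simp only [map_mul, map_div₀, Complex.conj_I, Complex.conj_ofReal, map_natCast, h2]
  ring

/-- if a `d`-periodic `c` (with `d ≥ 1`) satisfies the unitarity and Yang–Baxter
conditions, then so do the `d`-periodic functions `n ↦ e^{iφ} c n`, `n ↦ ω^n c n`, and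
`n ↦ conj (c (-n))`, for every real `φ`. -/
theorem statement3 (d : ℕ) (hd : 1 ≤ d) (c : ℤ → ℂ) (hper : IsPeriodic d c)
    (hU : UnitarityCond d c) (hYB : YangBaxterCond d c) (φ : ℝ) :
    (IsPeriodic d (fun n => Complex.exp (φ * Complex.I) * c n) ∧
      UnitarityCond d (fun n => Complex.exp (φ * Complex.I) * c n) ∧
      YangBaxterCond d (fun n => Complex.exp (φ * Complex.I) * c n)) ∧
    (IsPeriodic d (fun n => omegaC d ^ n * c n) ∧
      UnitarityCond d (fun n => omegaC d ^ n * c n) ∧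
      YangBaxterCond d (fun n => omegaC d ^ n * c n)) ∧
    (IsPeriodic d (fun n => (starRingEnd ℂ) (c (-n))) ∧
      UnitarityCond d (fun n => (starRingEnd ℂ) (c (-n))) ∧
      YangBaxterCond d (fun n => (starRingEnd ℂ) (c (-n)))) := by
  have w0 := omega_ne d
  have wd := omega_pow d hd
  have wdm : ∀ j : ℤ, omegaC d ^ ((d : ℤ) * j) = 1 := fun j => by
    rw [zpow_mul, wd, one_zpow]
  refine ⟨⟨?_, ?_, ?_⟩, ⟨?_, ?_, ?_⟩, ⟨?_, ?_, ?_⟩⟩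
  · intro m
    simp only [hper m]
  · intro r
    rw [← hU r]
    refine Finset.sum_congr rfl fun m _ => ?_
    have h : Complex.exp (φ * Complex.I) * (starRingEnd ℂ) (Complex.exp (φ * Complex.I)) = 1 := by
      rw [← Complex.exp_conj, ← Complex.exp_add]
      simp
    simp only [map_mul]
    linear_combination (c m * (starRingEnd ℂ) (c (m + r))) * h
  · intro k m
    have h := congrArg (fun z => Complex.exp (φ * Complex.I) ^ 3 * z) (hYB k m)
    simp only [Finset.mul_sum] at h
    convert h using 2 <;> ring
  · intro m
    simp only [hper m, zpow_add₀ w0, wd, mul_one]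
  · intro r
    have h : ∑ m ∈ Finset.range d, omegaC d ^ (m : ℤ) * c m *
        (starRingEnd ℂ) (omegaC d ^ (m + r : ℤ) * c (m + r)) =
        omegaC d ^ (-r) * ∑ m ∈ Finset.range d, c m * (starRingEnd ℂ) (c (m + r)) := by
      rw [Finset.mul_sum]
      refine Finset.sum_congr rfl fun m _ => ?_
      have h : omegaC d ^ (-r) = omegaC d ^ (m : ℤ) * (omegaC d)⁻¹ ^ (m + r : ℤ) := by
        rw [inv_zpow', ← zpow_add₀ w0]
        congr 1
        ring
      rw [map_mul, map_zpow₀, omega_conj, h]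
      ring
    refine h.trans ?_
    rw [hU r]
    split_ifs with hr
    · obtain ⟨j, rfl⟩ := hr
      rw [← mul_neg, wdm, one_mul]
    · simp
  · intro k m
    have h := congrArg (fun z => omegaC d ^ (k + m) * z) (hYB k m)
    simp only [Finset.mul_sum] at h
    convert h using 2 with r _ r _
    · have e : omegaC d ^ (k + m) = omegaC d ^ (r : ℤ) * omegaC d ^ (k - r) * omegaC d ^ m := by
        rw [← zpow_add₀ w0, ← zpow_add₀ w0]
        congr 1
        ring
      rw [e]
      ring
    · have e : omegaC d ^ (k + m) = omegaC d ^ (r : ℤ) * omegaC d ^ k * omegaC d ^ (m - r) := by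
        rw [← zpow_add₀ w0, ← zpow_add₀ w0]
        congr 1
        ring
      rw [e]
      ring
  · intro m
    have h := hper (-(m + d))
    rw [show -(m + d) + d = -m by ring] at h
    simp only [h]
  · intro r
    have h := congrArg (starRingEnd ℂ) (hU (-r))
    rw [map_sum, ← sum_neg' d (fun m => (starRingEnd ℂ) (c m * (starRingEnd ℂ) (c (m + -r))))] at h
    · convert h using 1
      · refine Finset.sum_congr rfl fun m _ => ?_
        simp only [map_mul, neg_add]
      · rw [apply_ite (starRingEnd ℂ)]
        simp
    · intro m
      simp only [hper m, add_right_comm m (d : ℤ), hper (m + -r)]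
  · have hper' : ∀ x y : ℤ, y = x + d → c x = c y := fun x y h => by rw [h, hper]
    intro k m
    have h := congrArg (fun z => (starRingEnd ℂ) (omegaC d ^ (-(k * m)) * z)) (hYB (-k) (-m))
    simp only [Finset.mul_sum, map_sum] at h
    have e1 := sum_shift d (fun r => (starRingEnd ℂ) (c (-r)) * (starRingEnd ℂ) (c (-(k - r))) *
      (starRingEnd ℂ) (c (-m)) * omegaC d ^ (m * r)) (fun r => by
        simp only [mul_add, zpow_add₀ w0, mul_comm m (d : ℤ), wdm, mul_one]
        rw [hper' (-(r + d)) (-r) (by ring), ← hper' (-(k - r)) (-(k - (r + d))) (by ring)]) k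
    have e2 := sum_shift d (fun r => (starRingEnd ℂ) (c (-r)) * (starRingEnd ℂ) (c (-k)) *
      (starRingEnd ℂ) (c (-(m - r))) * omegaC d ^ (k * r)) (fun r => by
        simp only [mul_add, zpow_add₀ w0, mul_comm k (d : ℤ), wdm, mul_one]
        rw [hper' (-(r + d)) (-r) (by ring), ← hper' (-(m - r)) (-(m - (r + d))) (by ring)]) m
    refine e1.symm.trans (Eq.trans ?_ e2)
    convert h using 2 with r _ r _
    · simp only [map_mul, map_zpow₀, omega_conj, inv_zpow']
      rw [show m * (r + k) = - -(k * m) + -(-m * r) by ring, zpow_add₀ w0,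
        show -((r : ℤ) + k) = -k - r by ring, show -(k - ((r : ℤ) + k)) = r by ring]
      ring
    · simp only [map_mul, map_zpow₀, omega_conj, inv_zpow']
      rw [show k * (r + m) = - -(k * m) + -(-k * r) by ring, zpow_add₀ w0,
        show -((r : ℤ) + m) = -m - r by ring, show -(m - ((r : ℤ) + m)) = r by ring]
      ring
end

section
/- For every integer d ≥ 1, every r ∈ ℤ, and every sign ε ∈ {1, −1}, the function c_{r,ε} : ℤ → ℂ defined by c_{r,ε}(m) = exp(ε·π·i·m·(m+2r+d)/d) is d-periodic (i.e., c_{r,ε}(m+d) = c_{r,ε}(m) for all m ∈ ℤ) and satisfies both the unitarity condition and the Yang–Baxter condition. -/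
open Complex

/-- The Frank–Zadoff–Chu sequence `c_{r,ε}(m) = exp(ε π i m (m + 2r + d) / d)`. -/
noncomputable def fzc (d : ℕ) (r ε : ℤ) (m : ℤ) : ℂ :=
  Complex.exp (ε * Real.pi * Complex.I * m * (m + 2 * r + d) / d)


lemma omegaC_zpow (d : ℕ) (n : ℤ) :
    omegaC d ^ n = Complex.exp (n * (2 * Real.pi * Complex.I / d)) := by
  rw [omegaC, Complex.exp_int_mul]

lemma omegaC_prim (d : ℕ) (hd : 1 ≤ d) : IsPrimitiveRoot (omegaC d) d :=
  Complex.isPrimitiveRoot_exp d (by omega)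

lemma fzc_add (d : ℕ) (r ε a b : ℤ) :
    fzc d r ε (a + b) = fzc d r ε a * fzc d r ε b * omegaC d ^ (ε * a * b) := by
  rw [omegaC_zpow]
  simp only [fzc]
  rw [← Complex.exp_add, ← Complex.exp_add]
  congr 1
  push_cast
  ring

lemma fzc_zero (d : ℕ) (r ε : ℤ) : fzc d r ε 0 = 1 := by simp [fzc]

lemma fzc_ne (d : ℕ) (r ε a : ℤ) : fzc d r ε a ≠ 0 := Complex.exp_ne_zero _

lemma fzc_conj (d : ℕ) (r ε a : ℤ) :
    (starRingEnd ℂ) (fzc d r ε a) = (fzc d r ε a)⁻¹ := by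
  simp only [fzc]
  rw [← Complex.exp_conj, ← Complex.exp_neg]
  congr 1
  have h2 : (starRingEnd ℂ) 2 = 2 := Complex.conj_ofNat 2
  simp [h2]
  ring

lemma fzc_d (d : ℕ) (hd : 1 ≤ d) (r ε : ℤ) : fzc d r ε d = 1 := by
  have h : (d : ℂ) ≠ 0 := by
    have : d ≠ 0 := by omega
    exact_mod_cast this
  rw [fzc, Complex.exp_eq_one_iff]
  refine ⟨ε * (d + r), ?_⟩
  push_cast
  field_simp
  ring

lemma omegaC_dvd (d : ℕ) (hd : 1 ≤ d) (n : ℤ) (h : (d : ℤ) ∣ n) : omegaC d ^ n = 1 :=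
  ((omegaC_prim d hd).zpow_eq_one_iff_dvd n).2 h

lemma fzc_per (d : ℕ) (hd : 1 ≤ d) (r ε m : ℤ) : fzc d r ε (m + d) = fzc d r ε m := by
  rw [fzc_add, fzc_d d hd, omegaC_dvd d hd _ (Dvd.intro_left _ rfl)]
  ring

lemma fzc_dvd (d : ℕ) (hd : 1 ≤ d) (r ε n : ℤ) (h : (d : ℤ) ∣ n) : fzc d r ε n = 1 := by
  obtain ⟨k, rfl⟩ := h
  have hp : Function.Periodic (fzc d r ε) (d : ℤ) := fzc_per d hd r ε
  have := hp.int_mul k 0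
  rw [zero_add, fzc_zero, mul_comm] at this
  simpa using this

lemma sum_neg_per (d : ℕ) (f : ℤ → ℂ) (hf : ∀ m, f (m + d) = f m) :
    ∑ r ∈ Finset.range d, f (-(r : ℤ)) = ∑ r ∈ Finset.range d, f r := by
  have h1 : ∑ r ∈ Finset.range d, f (-(r : ℤ)) = ∑ r ∈ Finset.range d, f ((r : ℤ) + 1) := by
    rw [← Finset.sum_range_reflect]
    refine Finset.sum_congr rfl fun j hj => ?_
    have := Finset.mem_range.1 hj
    rw [← hf]
    congr 1
    omega
  rw [h1]
  have h2 := Finset.sum_range_succ (fun j : ℕ => f (j : ℤ)) d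
  have h3 := Finset.sum_range_succ' (fun j : ℕ => f (j : ℤ)) d
  have h4 := hf 0
  rw [zero_add] at h4
  push_cast at h2 h3
  rw [h2, h4] at h3
  exact (add_right_cancel h3).symm

lemma fzc_sub (d : ℕ) (hd : 1 ≤ d) (s ε k r : ℤ) :
    fzc d s ε r * fzc d s ε (k - r) = fzc d s ε k * omegaC d ^ (ε * r * r - ε * k * r) := by
  have h0 : omegaC d ≠ 0 := Complex.exp_ne_zero _
  have h := fzc_add d s ε r (k - r)
  rw [add_sub_cancel] at h
  rw [h, mul_assoc, mul_assoc, ← zpow_add₀ h0]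
  have : ε * r * (k - r) + (ε * r * r - ε * k * r) = 0 := by ring
  rw [this, zpow_zero, mul_one]

/-- for every `d ≥ 1`, `r : ℤ` and sign `ε ∈ {1, -1}`, the function
`c_{r,ε}(m) = exp(ε π i m (m + 2r + d) / d)` is `d`-periodic and satisfies the unitarity
and Yang–Baxter conditions. -/
theorem statement4 (d : ℕ) (hd : 1 ≤ d) (r ε : ℤ) (hε : ε = 1 ∨ ε = -1) :
    IsPeriodic d (fzc d r ε) ∧ UnitarityCond d (fzc d r ε) ∧ YangBaxterCond d (fzc d r ε) := by
  have h0 : omegaC d ≠ 0 := Complex.exp_ne_zero _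
  refine ⟨fzc_per d hd r ε, fun n => ?_, fun k m => ?_⟩
  · have key : ∀ m : ℕ, fzc d r ε m * (starRingEnd ℂ) (fzc d r ε (m + n)) =
        (fzc d r ε n)⁻¹ * (omegaC d ^ (-(ε * n))) ^ m := by
      intro m
      rw [fzc_conj, fzc_add, ← zpow_natCast, ← zpow_mul, mul_inv, mul_inv, ← zpow_neg]
      have e : -(ε * n) * (m : ℤ) = -(ε * m * n) := by ring
      rw [e]
      have := fzc_ne d r ε m
      field_simp
    rw [Finset.sum_congr rfl fun m _ => key m, ← Finset.mul_sum]
    split_ifs with h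
    · rw [fzc_dvd d hd r ε n h, omegaC_dvd d hd _ ((h.mul_left ε).neg_right)]
      simp
    · have hne : omegaC d ^ (-(ε * n)) ≠ 1 := by
        intro h1
        rw [(omegaC_prim d hd).zpow_eq_one_iff_dvd] at h1
        apply h
        rcases hε with rfl | rfl <;> simpa using h1
      rw [geom_sum_eq hne, ← zpow_natCast, ← zpow_mul, omegaC_dvd d hd _ (Dvd.intro_left _ rfl)]
      simp
  · have hL : ∀ j : ℕ, fzc d r ε j * fzc d r ε (k - j) * fzc d r ε m * omegaC d ^ (m * j) =
        fzc d r ε k * fzc d r ε m * omegaC d ^ (ε * j * j - ε * k * j + m * j) := by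
      intro j
      rw [fzc_sub d hd, zpow_add₀ h0]
      ring
    have hR : ∀ j : ℕ, fzc d r ε j * fzc d r ε k * fzc d r ε (m - j) * omegaC d ^ (k * j) =
        fzc d r ε k * fzc d r ε m * omegaC d ^ (ε * j * j - ε * m * j + k * j) := by
      intro j
      rw [mul_right_comm (fzc d r ε j), fzc_sub d hd, zpow_add₀ h0]
      ring
    rw [Finset.sum_congr rfl fun j _ => hL j, Finset.sum_congr rfl fun j _ => hR j,
      ← Finset.mul_sum, ← Finset.mul_sum]
    congr 1
    rcases hε with rfl | rfl
    · rw [← sum_neg_per d (fun j : ℤ => omegaC d ^ (1 * j * j - 1 * m * j + k * j))]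
      · refine Finset.sum_congr rfl fun j _ => ?_
        congr 1
        ring
      · intro j
        have e : 1 * (j + (d : ℤ)) * (j + d) - 1 * m * (j + d) + k * (j + d) =
          (1 * j * j - 1 * m * j + k * j) + d * (2 * j + d - m + k) := by ring
        simp only [e]
        rw [zpow_add₀ h0, omegaC_dvd d hd _ (Dvd.intro _ rfl), mul_one]
    · refine Finset.sum_congr rfl fun j _ => ?_
      congr 1
      ring
end

section
/- Let d ≥ 1 and r ∈ ℤ. Then ∑_{m=0}^{d−1} exp(π·i·m·(m+2r+d)/d) = √d · exp(−π·i·r·(r+d)/d) · exp(π·i·(1−d)/4). -/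
open Complex

open Filter Topology

lemma aux_theta_lim (x b : ℝ) :
    Tendsto (fun u : ℝ => jacobiTheta₂ (x : ℂ) (I * u + b)) atTop (𝓝 1) := by
  have h1 : (1 : ℂ) = ∑' n : ℤ, (if n = 0 then 1 else 0) := by simp
  rw [h1]
  unfold jacobiTheta₂
  have hb := summable_pow_mul_jacobiTheta₂_term_bound 0 (T := 1) one_pos 0
  refine tendsto_tsum_of_dominated_convergence hb ?_ ?_
  · intro n
    by_cases hn : n = 0
    · subst hn
      simp [jacobiTheta₂_term]
    · simp only [hn, if_false]
      rw [tendsto_zero_iff_norm_tendsto_zero]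
      simp only [norm_jacobiTheta₂_term]
      have : ∀ u : ℝ, -Real.pi * n ^ 2 * (I * u + b).im - 2 * Real.pi * n * (x : ℂ).im
          = (-(Real.pi * n ^ 2)) * u := by
        intro u; simp
      simp only [this]
      refine Real.tendsto_exp_atBot.comp ?_
      refine (tendsto_const_mul_atBot_of_neg ?_).2 tendsto_id
      have : (0 : ℝ) < (n : ℝ) ^ 2 := by positivity
      have := mul_pos Real.pi_pos this
      linarith
  · filter_upwards [eventually_ge_atTop 1] with u hu n
    have := norm_jacobiTheta₂_term_le (S := 0) (T := 1) one_pos (z := (x : ℂ))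
      (τ := I * u + b) (by simp) (by simpa using hu) n
    simpa using this

lemma aux_exp_int (k : ℤ) (x y : ℂ) (h : x = y + k * (2 * Real.pi * I)) :
    exp x = exp y := by
  rw [h]; exact Complex.exp_periodic.int_mul k y

lemma aux_cpow (u : ℝ) (hu : 0 < u) (x : ℂ) (hx : x ≠ 0) (s : ℂ) :
    ((u : ℂ) * x) ^ s = (u : ℂ) ^ s * x ^ s := by
  have hu0 : (u : ℂ) ≠ 0 := by exact_mod_cast hu.ne'
  rw [Complex.cpow_def_of_ne_zero (mul_ne_zero hu0 hx), Complex.cpow_def_of_ne_zero hu0,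
    Complex.cpow_def_of_ne_zero hx, Complex.log_ofReal_mul hu hx, Complex.ofReal_log hu.le,
    ← Complex.exp_add, add_mul]

/-- Splitting into residue classes. -/
lemma aux_split (d : ℕ) (hd : 1 ≤ d) (f : ℤ → ℂ) (hf : Summable f) :
    ∑' n, f n = ∑ a ∈ Finset.range d, ∑' k : ℤ, f (k * d + a) := by
  have : NeZero d := ⟨by omega⟩
  have hs : Summable (fun p : ℤ × Fin d => f (p.1 * d + (p.2 : ℕ))) :=
    (Int.divModEquiv d).symm.summable_iff.2 hf
  rw [← (Int.divModEquiv d).symm.tsum_eq]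
  have e : ∀ p : ℤ × Fin d, (Int.divModEquiv d).symm p = p.1 * d + (p.2 : ℕ) := fun p => rfl
  simp only [e]
  have hs' := (Equiv.prodComm (Fin d) ℤ).summable_iff.2 hs
  rw [← (Equiv.prodComm (Fin d) ℤ).tsum_eq]
  refine hs'.tsum_prod.trans ?_
  rw [tsum_fintype, Finset.sum_range]
  rfl

/-- First evaluation of the theta function near `1/d`. -/
lemma aux_left (d : ℕ) (hd : 1 ≤ d) (u : ℝ) (hu : 0 < u) :
    jacobiTheta₂ (1 / 2) (1 / d + I / (d ^ 2 * u)) =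
      ∑ a ∈ Finset.range d, exp (Real.pi * I * a * (a + d) / d) *
        ((u : ℂ) ^ (1 / 2 : ℂ) * jacobiTheta₂ ((a / d : ℝ) : ℂ) (I * u + (0 : ℝ))) := by
  have hd0 : (d : ℂ) ≠ 0 := by exact_mod_cast (by omega : d ≠ 0)
  have hdr : (0 : ℝ) < d := by exact_mod_cast hd
  have hu0 : (u : ℂ) ≠ 0 := by exact_mod_cast hu.ne'
  have him : 0 < (1 / d + I / (d ^ 2 * u) : ℂ).im := by
    have : (1 / d + I / (d ^ 2 * u) : ℂ) = ((1 / d : ℝ) : ℂ) + ((1 / (d ^ 2 * u) : ℝ) : ℂ) * I := by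
      push_cast; ring
    rw [this, add_im, ofReal_im, mul_I_im, ofReal_re]
    positivity
  unfold jacobiTheta₂
  rw [aux_split d hd _ ((summable_jacobiTheta₂_term_iff _ _).2 him)]
  refine Finset.sum_congr rfl fun a _ => ?_
  have key : ∀ k : ℤ, jacobiTheta₂_term (k * d + a) (1 / 2) (1 / d + I / (d ^ 2 * u)) =
      exp (Real.pi * I * a * (a + d) / d) * exp (-Real.pi * a ^ 2 / (d ^ 2 * u)) *
        jacobiTheta₂_term k (I * a / (d * u)) (I / u) := by
    intro k
    unfold jacobiTheta₂_term
    rw [← Complex.exp_add, ← Complex.exp_add]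
    obtain ⟨q, hq⟩ : Even (k * (k + 1) * d) := (Int.even_mul_succ_self k).mul_right _
    have hq' : (k : ℂ) * (k + 1) * d = q + q := by exact_mod_cast congrArg (Int.cast (R := ℂ)) hq
    refine aux_exp_int (q + k * a) _ _ ?_
    push_cast
    have : (q : ℂ) = k * (k + 1) * d / 2 := by rw [hq']; ring
    rw [this]
    field_simp
    ring_nf
    simp only [I_sq]
    ring
  simp only [key, tsum_mul_left]
  rw [mul_assoc]
  congr 1
  change _ * jacobiTheta₂ (I * a / (d * u)) (I / u) = _ * jacobiTheta₂ _ _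
  rw [jacobiTheta₂_functional_equation (I * a / (d * u)) (I / u)]
  have e1 : (I * a / (d * u) / (I / u) : ℂ) = ((a / d : ℝ) : ℂ) := by
    push_cast; field_simp
  have e2 : (-1 / (I / u) : ℂ) = I * u + (0 : ℝ) := by
    push_cast; field_simp; linear_combination (-(u : ℂ)) * I_sq
  have e3 : (-I * (I / u) : ℂ) = (u : ℂ)⁻¹ := by
    rw [← mul_div_assoc]; simp
  have e4 : ((u : ℂ)⁻¹) ^ (1 / 2 : ℂ) = ((u : ℂ) ^ (1 / 2 : ℂ))⁻¹ := by
    rw [Complex.inv_cpow]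
    rw [Complex.arg_ofReal_of_nonneg hu.le]; exact Real.pi_pos.ne
  have e5 : exp (-Real.pi * a ^ 2 / (d ^ 2 * u)) *
      exp (-Real.pi * I * (I * a / (d * u)) ^ 2 / (I / u)) = 1 := by
    rw [← Complex.exp_add, Complex.exp_eq_one_iff]
    refine ⟨0, ?_⟩
    field_simp
    ring_nf
    simp
  rw [e1, e2, e3, e4]
  rw [one_div, inv_inv]
  linear_combination ((u : ℂ) ^ (1 / 2 : ℂ) * jacobiTheta₂ ((a / d : ℝ) : ℂ) (I * u + (0 : ℝ))) * e5

/-- Second evaluation of the theta function near `1/d`. -/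
lemma aux_right (d : ℕ) (hd : 1 ≤ d) (u : ℝ) (hu : 0 < u) :
    jacobiTheta₂ (1 / 2) (1 / d + I / (d ^ 2 * u)) =
      1 / (1 / (d ^ 2 * u) - I / d : ℂ) ^ (1 / 2 : ℂ) * exp (-Real.pi * I * d / 4) *
        ((u : ℂ) ^ (1 / 2 : ℂ) * (1 + I / (d * u) : ℂ) ^ (1 / 2 : ℂ) *
          jacobiTheta₂ ((1 / 2 : ℝ) : ℂ) (I * u + (-1 / d : ℝ))) := by
  have hd0 : (d : ℂ) ≠ 0 := by exact_mod_cast (by omega : d ≠ 0)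
  have hu0 : (u : ℂ) ≠ 0 := by exact_mod_cast hu.ne'
  obtain ⟨w, hw⟩ : ∃ w : ℂ, w = I * u + (-1 / d : ℝ) := ⟨_, rfl⟩
  obtain ⟨τ, hτ⟩ : ∃ τ : ℂ, τ = 1 / d + I / (d ^ 2 * u) := ⟨_, rfl⟩
  have hw0 : w ≠ 0 := by
    intro h
    have := congrArg Complex.im (hw.symm.trans h)
    simp only [add_im, ofReal_im, I_mul_im, ofReal_re, add_zero, zero_im] at this
    exact hu.ne' this
  have hwτ : τ = w / (d * I * u) := by
    rw [hτ, hw]; push_cast; field_simp; ring_nf; simp; ring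
  have hτ0 : τ ≠ 0 := by
    rw [hwτ]; exact div_ne_zero hw0 (by simp [hd0, hu0])
  have hinv : 1 / τ = d + 1 / w := by
    rw [hwτ]
    field_simp
    rw [hw]; push_cast; field_simp; ring
  rw [← hw, ← hτ]
  have h2 := jacobiTheta₂_functional_equation (1 / 2) τ
  have h3 := jacobiTheta₂_functional_equation (1 / 2) w
  have e1 : jacobiTheta₂ (1 / 2 / τ) (-1 / τ) = jacobiTheta₂ (1 / 2 / w) (-1 / w) := by
    unfold jacobiTheta₂
    refine tsum_congr fun n => ?_
    unfold jacobiTheta₂_term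
    obtain ⟨q, hq⟩ : Even (n * (n - 1) * d) := (Int.even_mul_pred_self n).mul_right _
    have hq' : (n : ℂ) * (n - 1) * d = q + q := by exact_mod_cast congrArg (Int.cast (R := ℂ)) hq
    refine aux_exp_int (-q) _ _ ?_
    have a1 : 1 / 2 / τ = 1 / 2 * (d + 1 / w) := by rw [← hinv]; ring
    have a2 : -1 / τ = -(d + 1 / w) := by rw [← hinv]; ring
    rw [a1, a2]
    push_cast
    have : (q : ℂ) = n * (n - 1) * d / 2 := by rw [hq']; ring
    rw [this]; ring
  have e2 : exp (-Real.pi * I * (1 / 2) ^ 2 / τ) =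
      exp (-Real.pi * I * d / 4) * exp (-Real.pi * I * (1 / 2) ^ 2 / w) := by
    rw [← Complex.exp_add]; congr 1
    linear_combination (-Real.pi * I * (1 / 2) ^ 2) * hinv
  have e3 : -I * τ = 1 / (d ^ 2 * u) - I / d := by
    rw [hτ]; linear_combination (-1 / (d ^ 2 * u) : ℂ) * I_sq
  have e4 : -I * w = (u : ℂ) * (1 + I / (d * u)) := by
    rw [hw]; push_cast; field_simp; ring_nf; simp
  have e5 : (-I * w) ^ (1 / 2 : ℂ) = (u : ℂ) ^ (1 / 2 : ℂ) * (1 + I / (d * u) : ℂ) ^ (1 / 2 : ℂ) := by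
    rw [e4]
    refine aux_cpow u hu _ ?_ _
    intro h
    apply hw0
    have h5 : -I * w = 0 := by rw [e4, h, mul_zero]
    simpa using h5
  have e6 : (-I * w) ^ (1 / 2 : ℂ) ≠ 0 := by
    rw [Ne, Complex.cpow_eq_zero_iff]; simp [hw0]
  rw [h2, e1, e2, e3, ← e5]
  have e7 : ((1 / 2 : ℝ) : ℂ) = 1 / 2 := by push_cast; rfl
  rw [e7, h3]
  field_simp

lemma aux_base (d : ℕ) (hd : 1 ≤ d) :
    ∑ a ∈ Finset.range d, exp (Real.pi * I * a * (a + d) / d) =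
      (Real.sqrt d : ℂ) * exp (Real.pi * I * (1 - d) / 4) := by
  have hd0 : (d : ℂ) ≠ 0 := by exact_mod_cast (by omega : d ≠ 0)
  have hdr : (0 : ℝ) < d := by exact_mod_cast hd
  have hL : Tendsto (fun u : ℝ => ∑ a ∈ Finset.range d, exp (Real.pi * I * a * (a + d) / d) *
      jacobiTheta₂ ((a / d : ℝ) : ℂ) (I * u + (0 : ℝ))) atTop
      (𝓝 (∑ a ∈ Finset.range d, exp (Real.pi * I * a * (a + d) / d) * 1)) :=
    tendsto_finsetSum _ fun a _ => (aux_theta_lim _ _).const_mul _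
  have hinv : Tendsto (fun u : ℝ => ((u⁻¹ : ℝ) : ℂ)) atTop (𝓝 0) := by
    have := (Complex.continuous_ofReal.tendsto 0).comp tendsto_inv_atTop_zero
    simpa [Function.comp_def] using this
  have hA : Tendsto (fun u : ℝ => (1 / (d ^ 2 * u) - I / d : ℂ) ^ (1 / 2 : ℂ)) atTop
      (𝓝 ((-I / d : ℂ) ^ (1 / 2 : ℂ))) := by
    refine Tendsto.cpow ?_ tendsto_const_nhds ?_
    · have := (hinv.const_mul (1 / d ^ 2 : ℂ)).sub_const (I / d)
      convert this using 2
      · push_cast; field_simp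
      · ring
    · right
      have : (-I / d : ℂ) = ((-1 / d : ℝ) : ℂ) * I := by push_cast; ring
      rw [this, mul_I_im, ofReal_re]
      exact (div_neg_of_neg_of_pos (by norm_num) hdr).ne
  have hB : Tendsto (fun u : ℝ => (1 + I / (d * u) : ℂ) ^ (1 / 2 : ℂ)) atTop
      (𝓝 ((1 : ℂ) ^ (1 / 2 : ℂ))) := by
    refine Tendsto.cpow ?_ tendsto_const_nhds (by simp)
    have := (hinv.const_mul (I / d : ℂ)).const_add 1
    convert this using 2
    · push_cast; field_simp
    · ring
  have hAne : (-I / d : ℂ) ^ (1 / 2 : ℂ) ≠ 0 := by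
    rw [Ne, Complex.cpow_eq_zero_iff]; simp [hd0]
  have hR := (((tendsto_const_nhds (x := (1 : ℂ))).div hA hAne).mul_const
    (exp (-Real.pi * I * d / 4))).mul (hB.mul (aux_theta_lim (1 / 2) (-1 / d)))
  have hEq := tendsto_nhds_unique_of_eventuallyEq hL hR (by
    filter_upwards [eventually_gt_atTop 0] with u hu
    have hu0 : (u : ℂ) ^ (1 / 2 : ℂ) ≠ 0 := by
      rw [Ne, Complex.cpow_eq_zero_iff]; simp [hu.ne']
    have h := (aux_left d hd u hu).symm.trans (aux_right d hd u hu)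
    apply mul_left_cancel₀ hu0
    rw [Finset.mul_sum]
    refine Eq.trans (Finset.sum_congr rfl fun a _ => ?_) (h.trans ?_)
    · ring
    · simp only [Pi.div_apply]; ring)
  simp only [mul_one, Complex.one_cpow] at hEq
  rw [hEq]
  have hval : (-I / d : ℂ) ^ (1 / 2 : ℂ) = (Real.sqrt d : ℂ)⁻¹ * exp (-(Real.pi * I / 4)) := by
    have h1 : (-I / d : ℂ) = (((d : ℝ)⁻¹ : ℝ) : ℂ) * -I := by push_cast; ring
    rw [h1, aux_cpow _ (inv_pos.2 hdr) _ (by simp)]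
    congr 1
    · have h2 : (1 / 2 : ℂ) = ((1 / 2 : ℝ) : ℂ) := by push_cast; rfl
      rw [h2, ← Complex.ofReal_cpow (inv_pos.2 hdr).le, ← Real.sqrt_eq_rpow, Real.sqrt_inv]
      push_cast; rfl
    · rw [Complex.cpow_def_of_ne_zero (by simp), Complex.log_neg_I]
      congr 1; ring
  rw [hval, one_div, mul_inv, inv_inv, ← Complex.exp_neg, mul_assoc, ← Complex.exp_add]
  congr 2
  ring

lemma aux_shift (d : ℕ) (f : ℤ → ℂ) (hf : ∀ n, f (n + d) = f n) (r : ℤ) :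
    ∑ m ∈ Finset.range d, f (m + r) = ∑ m ∈ Finset.range d, f m := by
  have step : ∀ r : ℤ, ∑ m ∈ Finset.range d, f (m + (r + 1)) = ∑ m ∈ Finset.range d, f (m + r) := by
    intro r
    have h1 := Finset.sum_range_succ (fun m : ℕ => f (m + r)) d
    have h2 := Finset.sum_range_succ' (fun m : ℕ => f (m + r)) d
    have h3 : f ((d : ℕ) + r) = f ((0 : ℕ) + r) := by
      rw [add_comm, hf]; simp
    rw [h1, h3] at h2
    have h4 := add_right_cancel h2
    rw [h4]
    refine Finset.sum_congr rfl fun m _ => ?_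
    congr 1; push_cast; ring
  induction r using Int.induction_on with
  | zero => simp
  | succ i ih => rw [step, ih]
  | pred i ih => rw [← ih, ← step]; simp

/-- the generalized quadratic Gauss sum evaluation
`∑_{m=0}^{d-1} exp(π i m (m + 2r + d) / d) = √d · exp(-π i r (r + d) / d) · exp(π i (1 - d)/4)`
for every `d ≥ 1` and `r : ℤ`. -/
theorem statement7 (d : ℕ) (hd : 1 ≤ d) (r : ℤ) :
    ∑ m ∈ Finset.range d, Complex.exp (Real.pi * Complex.I * m * (m + 2 * r + d) / d) =
      (Real.sqrt d : ℂ) * Complex.exp (-(Real.pi * Complex.I * r * (r + d)) / d) *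
        Complex.exp (Real.pi * Complex.I * (1 - d) / 4) := by
  have hd0 : (d : ℂ) ≠ 0 := by exact_mod_cast (by omega : d ≠ 0)
  have hs := aux_shift d (fun n : ℤ => exp (Real.pi * I * n * (n + d) / d)) (by
    intro n
    refine aux_exp_int (n + d) _ _ ?_
    push_cast
    field_simp
    ring) r
  simp only [Int.cast_natCast] at hs
  rw [aux_base d hd] at hs
  rw [mul_right_comm, ← hs, Finset.sum_mul]
  refine Finset.sum_congr rfl fun m _ => ?_
  rw [← Complex.exp_add]
  congr 1
  push_cast
  field_simp
  ring
end

section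
/- Let d ≥ 1 and N ≥ 2 be integers, ω = exp(2πi/d), and let γ_1, …, γ_N be unitary complex matrices (of some common size) satisfying the parafermion relations: γ_a^d = 1 for every a, and γ_a·γ_b = ω·γ_b·γ_a whenever a < b. For 1 ≤ i ≤ N−1 define the parity operator Λ_i = exp(πi(d+1)/d)·γ_i·γ_{i+1}^†, where † is the conjugate transpose. Then: (i) Λ_i^d = 1 for every i; (ii) Λ_i·Λ_j = Λ_j·Λ_i whenever |i−j| > 1; and (iii) Λ_i·Λ_{i+1} = ω·Λ_{i+1}·Λ_i for every i with 1 ≤ i ≤ N−2. -/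
open Complex Matrix

section Helpers

variable {R : Type*} [Ring R] [Algebra ℂ R]

lemma qinv {ω : ℂ} {X Y Z : R} (h : X * Y = ω • (Y * X)) (h1 : Y * Z = 1) (h2 : Z * Y = 1) :
    Z * X = ω • (X * Z) := by
  calc Z * X = Z * (X * Y) * Z := by
        rw [mul_assoc, mul_assoc, h1, mul_one]
    _ = ω • ((Z * Y) * (X * Z)) := by
        rw [h]; simp only [mul_smul_comm, smul_mul_assoc, mul_assoc]
    _ = ω • (X * Z) := by rw [h2, one_mul]

lemma qpow1 {ω : ℂ} {X Y : R} (h : Y * X = ω • (X * Y)) (n : ℕ) :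
    Y ^ n * X = ω ^ n • (X * Y ^ n) := by
  induction n with
  | zero => simp
  | succ n ih =>
    rw [pow_succ, mul_assoc, h, mul_smul_comm, ← mul_assoc, ih, smul_mul_assoc, smul_smul,
      mul_assoc, ← pow_succ']

lemma qpow2 {ω : ℂ} {X Y : R} (h : Y * X = ω • (X * Y)) (n : ℕ) :
    (X * Y) ^ n = ω ^ (n * (n - 1) / 2) • (X ^ n * Y ^ n) := by
  rw [← Finset.sum_range_id]
  induction n with
  | zero => simp
  | succ n ih =>
    rw [pow_succ, ih, Finset.sum_range_succ, smul_mul_assoc]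
    have : X ^ n * Y ^ n * (X * Y) = ω ^ n • (X ^ (n + 1) * Y ^ (n + 1)) := by
      calc X ^ n * Y ^ n * (X * Y) = X ^ n * (Y ^ n * X) * Y := by simp only [mul_assoc]
        _ = _ := by
          rw [qpow1 h]
          simp only [mul_smul_comm, smul_mul_assoc, mul_assoc, pow_succ]
    rw [this, smul_smul, pow_add ω]

/-- Two elements both `ω`-commuting past `Z` give a commuting product. -/
lemma qcomm {ω : ℂ} (hω : ω ≠ 0) {A B Z : R} (h1 : A * Z = ω • (Z * A))
    (h2 : Z * B = ω • (B * Z)) : (A * B) * Z = Z * (A * B) := by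
  have : B * Z = ω⁻¹ • (Z * B) := by rw [h2, smul_smul, inv_mul_cancel₀ hω, one_smul]
  rw [mul_assoc, this, mul_smul_comm, ← mul_assoc, h1, smul_mul_assoc, smul_smul,
    inv_mul_cancel₀ hω, one_smul, mul_assoc]

lemma qcomm' {ω : ℂ} (hω : ω ≠ 0) {A B Z : R} (h1 : Z * A = ω • (A * Z))
    (h2 : B * Z = ω • (Z * B)) : (A * B) * Z = Z * (A * B) := by
  have : A * Z = ω⁻¹ • (Z * A) := by rw [h1, smul_smul, inv_mul_cancel₀ hω, one_smul]
  rw [mul_assoc, h2, mul_smul_comm, ← mul_assoc, this, smul_mul_assoc, smul_smul,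
    mul_inv_cancel₀ hω, one_smul, mul_assoc]

end Helpers

lemma phase (d : ℕ) (hd : 1 ≤ d) :
    Complex.exp (Real.pi * Complex.I * (d + 1) / d) ^ d *
      Complex.exp (2 * Real.pi * Complex.I / d) ^ (d * (d - 1) / 2) = 1 := by
  have hd0 : (d : ℂ) ≠ 0 := by exact_mod_cast (by omega : d ≠ 0)
  have h2 : ((d * (d - 1) / 2 : ℕ) : ℂ) = d * (d - 1) / 2 := by
    rw [Nat.cast_div (even_iff_two_dvd.mp (Nat.even_mul_pred_self d)) (by norm_num)]
    push_cast [Nat.cast_sub hd]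
    ring
  rw [← Complex.exp_nat_mul, ← Complex.exp_nat_mul, ← Complex.exp_add, h2, Complex.exp_eq_one_iff]
  refine ⟨d, ?_⟩
  push_cast
  field_simp
  ring

/-- let `γ_1, …, γ_N` (`N ≥ 2`) be unitary complex matrices of a common size
satisfying the parafermion relations `γ_a ^ d = 1` and `γ_a γ_b = ω γ_b γ_a` for `a < b`,
with `ω = exp(2πi/d)`, `d ≥ 1`. Define the parity operators
`Λ_i = e^{πi(d+1)/d} γ_i γ_{i+1}ᴴ` for `1 ≤ i ≤ N-1`. Then (i) `Λ_i ^ d = 1`;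
(ii) `Λ_i Λ_j = Λ_j Λ_i` whenever `|i - j| > 1`; and (iii) `Λ_i Λ_{i+1} = ω Λ_{i+1} Λ_i`
for `1 ≤ i ≤ N-2`. -/
theorem statement9 {ι : Type*} [Fintype ι] [DecidableEq ι] (d N : ℕ) (hd : 1 ≤ d) (hN : 2 ≤ N)
    (ω : ℂ) (hω : ω = Complex.exp (2 * Real.pi * Complex.I / d))
    (γ : ℕ → Matrix ι ι ℂ)
    (hunit : ∀ a, 1 ≤ a → a ≤ N → γ a * (γ a)ᴴ = 1 ∧ (γ a)ᴴ * γ a = 1)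
    (hpow : ∀ a, 1 ≤ a → a ≤ N → γ a ^ d = 1)
    (hcomm : ∀ a b, 1 ≤ a → a < b → b ≤ N → γ a * γ b = ω • (γ b * γ a))
    (Λ : ℕ → Matrix ι ι ℂ)
    (hΛ : ∀ i, 1 ≤ i → i + 1 ≤ N →
      Λ i = Complex.exp (Real.pi * Complex.I * (d + 1) / d) • (γ i * (γ (i + 1))ᴴ)) :
    (∀ i, 1 ≤ i → i + 1 ≤ N → Λ i ^ d = 1) ∧
    (∀ i j, 1 ≤ i → i + 1 ≤ N → 1 ≤ j → j + 1 ≤ N → 1 < |(i : ℤ) - (j : ℤ)| →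
      Λ i * Λ j = Λ j * Λ i) ∧
    (∀ i, 1 ≤ i → i + 2 ≤ N → Λ i * Λ (i + 1) = ω • (Λ (i + 1) * Λ i)) := by
  have hω0 : ω ≠ 0 := by rw [hω]; exact Complex.exp_ne_zero _
  -- `γ_bᴴ γ_a = ω γ_a γ_bᴴ` for `a < b`
  have hB : ∀ a b, 1 ≤ a → a < b → b ≤ N → (γ b)ᴴ * γ a = ω • (γ a * (γ b)ᴴ) :=
    fun a b h1 h2 h3 => qinv (hcomm a b h1 h2 h3) (hunit b (by omega) h3).1
      (hunit b (by omega) h3).2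
  -- `γ_aᴴ γ_bᴴ = ω γ_bᴴ γ_aᴴ`
  have hC : ∀ a b, 1 ≤ a → a < b → b ≤ N → (γ a)ᴴ * (γ b)ᴴ = ω • ((γ b)ᴴ * (γ a)ᴴ) :=
    fun a b h1 h2 h3 => qinv (hB a b h1 h2 h3) (hunit a h1 (by omega)).1
      (hunit a h1 (by omega)).2
  -- `γ_b γ_aᴴ = ω γ_aᴴ γ_b`
  have hD : ∀ a b, 1 ≤ a → a < b → b ≤ N → γ b * (γ a)ᴴ = ω • ((γ a)ᴴ * γ b) :=
    fun a b h1 h2 h3 => qinv (hC a b h1 h2 h3) (hunit b (by omega) h3).2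
      (hunit b (by omega) h3).1
  have key : ∀ i j, 1 ≤ i → i + 1 < j → j + 1 ≤ N → Λ i * Λ j = Λ j * Λ i := by
    intro i j hi hij hj
    rw [hΛ i hi (by omega), hΛ j (by omega) hj]
    simp only [smul_mul_assoc, mul_smul_comm]
    congr 2
    have e1 := qcomm hω0 (hcomm i j hi (by omega) (by omega))
      (hD (i + 1) j (by omega) (by omega) (by omega))
    have e2 := qcomm' hω0 (hB i (j + 1) hi (by omega) (by omega))
      (hC (i + 1) (j + 1) (by omega) (by omega) (by omega))
    rw [← mul_assoc, e1, mul_assoc, e2, ← mul_assoc]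
  refine ⟨?_, ?_, ?_⟩
  · intro i hi hiN
    rw [hΛ i hi hiN, smul_pow, qpow2 (hB i (i + 1) hi (by omega) hiN), hpow i hi (by omega),
      ← conjTranspose_pow, hpow (i + 1) (by omega) hiN, conjTranspose_one, mul_one, smul_smul,
      hω, phase d hd, one_smul]
  · intro i j hi hiN hj hjN hij
    rcases lt_abs.mp hij with h | h
    · exact (key j i hj (by omega) hiN).symm
    · exact key i j hi (by omega) hjN
  · intro i hi hiN
    rw [hΛ i hi (by omega), hΛ (i + 1) (by omega) (by omega)]
    simp only [smul_mul_assoc, mul_smul_comm]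
    rw [smul_comm ω, smul_comm ω]
    congr 2
    have e1 : γ i * (γ (i + 1))ᴴ * (γ (i + 1) * (γ (i + 1 + 1))ᴴ) = γ i * (γ (i + 1 + 1))ᴴ := by
      rw [mul_assoc, ← mul_assoc (γ (i + 1))ᴴ, (hunit (i + 1) (by omega) (by omega)).2, one_mul]
    have h1 := hB i (i + 1) hi (by omega) (by omega)
    have h2 := hC (i + 1) (i + 1 + 1) (by omega) (by omega) (by omega)
    have h3 := hB i (i + 1 + 1) hi (by omega) (by omega)
    have hu := (hunit (i + 1) (by omega) (by omega)).1
    rw [e1, ← mul_smul_comm, ← h1]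
    apply smul_right_injective _ hω0
    change ω • (γ i * (γ (i + 1 + 1))ᴴ) =
      ω • (γ (i + 1) * (γ (i + 1 + 1))ᴴ * ((γ (i + 1))ᴴ * γ i))
    rw [← h3]
    calc (γ (i + 1 + 1))ᴴ * γ i
        = γ (i + 1) * ((γ (i + 1))ᴴ * (γ (i + 1 + 1))ᴴ) * γ i := by
          rw [← mul_assoc (γ (i + 1)), hu, one_mul]
      _ = _ := by
          rw [h2]
          simp only [smul_mul_assoc, mul_smul_comm, mul_assoc]
end

section
/- Let d ≥ 1, n ≥ 1, ω = exp(2πi/d), and let γ_1, …, γ_{2n} be unitary complex matrices satisfying the parafermion relations (γ_a^d = 1 and γ_a·γ_b = ω·γ_b·γ_a for a < b), with parity operators Λ_i = exp(πi(d+1)/d)·γ_i·γ_{i+1}^† for 1 ≤ i ≤ 2n−1. Let c : ℤ → ℂ be any function and define the braid operators U_j = (1/√d)·∑_{m=0}^{d−1} c(m)·Λ_j^m for 1 ≤ j ≤ 2n−1. Then the total parity operator Λ_1·Λ_3·⋯·Λ_{2n−1} commutes with U_j for every j. -/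
open Complex Matrix

def QC {ι : Type*} [Fintype ι] (z : ℂ) (x y : Matrix ι ι ℂ) : Prop := x * y = z • (y * x)

section
variable {ι : Type*} [Fintype ι]

theorem QC.mul_left {z w : ℂ} {x x' y : Matrix ι ι ℂ} (h : QC z x y) (h' : QC w x' y) :
    QC (z * w) (x * x') y := by
  unfold QC at *
  rw [mul_assoc, h', mul_smul_comm, ← mul_assoc, h, smul_mul_assoc, smul_smul, mul_assoc, mul_comm w]

theorem QC.symm {z : ℂ} {x y : Matrix ι ι ℂ} (hz : z ≠ 0) (h : QC z x y) : QC z⁻¹ y x := by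
  unfold QC at *
  rw [h, smul_smul, inv_mul_cancel₀ hz, one_smul]

theorem QC.mul_right {z w : ℂ} {x y y' : Matrix ι ι ℂ} (h : QC z x y) (h' : QC w x y') :
    QC (z * w) x (y * y') := by
  unfold QC at *
  rw [← mul_assoc, h, smul_mul_assoc, mul_assoc, h', mul_smul_comm, smul_smul, mul_assoc]

theorem QC.smul_left {z : ℂ} {x y : Matrix ι ι ℂ} (e : ℂ) (h : QC z x y) : QC z (e • x) y := by
  unfold QC at *
  rw [smul_mul_assoc, h, mul_smul_comm, smul_comm]

theorem QC.smul_right {z : ℂ} {x y : Matrix ι ι ℂ} (e : ℂ) (h : QC z x y) : QC z x (e • y) := by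
  unfold QC at *
  rw [smul_mul_assoc, mul_smul_comm, h, smul_comm]

theorem QC.inv_right [DecidableEq ι] {z : ℂ} {x y y' : Matrix ι ι ℂ} (hz : z ≠ 0) (h1 : y * y' = 1)
    (h2 : y' * y = 1) (h : QC z x y) : QC z⁻¹ x y' := by
  unfold QC at *
  have : y' * (x * y) * y' = y' * (z • (y * x)) * y' := by rw [h]
  rw [mul_smul_comm, smul_mul_assoc, ← mul_assoc y' y, h2, one_mul, ← mul_assoc, mul_assoc _ y, h1,
    mul_one] at this
  rw [this, smul_smul, inv_mul_cancel₀ hz, one_smul]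

theorem QC.inv_left [DecidableEq ι] {z : ℂ} {x y y' : Matrix ι ι ℂ} (hz : z ≠ 0) (h1 : y * y' = 1)
    (h2 : y' * y = 1) (h : QC z y x) : QC z⁻¹ y' x := by
  have := ((h.symm hz).inv_right (inv_ne_zero hz) h1 h2).symm (by simpa using hz)
  simpa using this
end

/-- let `γ_1, …, γ_{2n}` be unitary matrices satisfying the parafermion
relations (`γ_a ^ d = 1`, and `γ_a γ_b = ω γ_b γ_a` for `a < b`, with `ω = exp(2πi/d)`),
with parity operators `Λ_i = e^{πi(d+1)/d} γ_i γ_{i+1}ᴴ` for `1 ≤ i ≤ 2n-1`. For any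
`c : ℤ → ℂ`, define the braid operators `U_j = (1/√d) ∑_{m=0}^{d-1} c(m) Λ_j^m`. Then the
total parity operator `Λ_1 Λ_3 ⋯ Λ_{2n-1}` commutes with `U_j` for every `1 ≤ j ≤ 2n-1`. -/
theorem statement11 {ι : Type*} [Fintype ι] [DecidableEq ι] (d n : ℕ) (hd : 1 ≤ d)
    (hn : 1 ≤ n) (ω : ℂ) (hω : ω = Complex.exp (2 * Real.pi * Complex.I / d))
    (γ : ℕ → Matrix ι ι ℂ)
    (hunit : ∀ a, 1 ≤ a → a ≤ 2 * n → γ a * (γ a)ᴴ = 1 ∧ (γ a)ᴴ * γ a = 1)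
    (hpow : ∀ a, 1 ≤ a → a ≤ 2 * n → γ a ^ d = 1)
    (hcomm : ∀ a b, 1 ≤ a → a < b → b ≤ 2 * n → γ a * γ b = ω • (γ b * γ a))
    (Λ : ℕ → Matrix ι ι ℂ)
    (hΛ : ∀ i, 1 ≤ i → i + 1 ≤ 2 * n →
      Λ i = Complex.exp (Real.pi * Complex.I * (d + 1) / d) • (γ i * (γ (i + 1))ᴴ))
    (c : ℤ → ℂ) (U : ℕ → Matrix ι ι ℂ)
    (hU : ∀ j, 1 ≤ j → j + 1 ≤ 2 * n →
      U j = ((Real.sqrt d : ℂ))⁻¹ • ∑ m ∈ Finset.range d, c m • Λ j ^ m)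
    (P : Matrix ι ι ℂ)
    (hP : P = (((List.range n).map (fun i => Λ (2 * i + 1)))).prod) :
    ∀ j, 1 ≤ j → j + 1 ≤ 2 * n → P * U j = U j * P := by
  have hω0 : ω ≠ 0 := hω ▸ Complex.exp_ne_zero _
  have hself : ∀ a, QC 1 (γ a) (γ a) := fun a => by simp [QC]
  have hlt : ∀ a b, 1 ≤ a → a < b → b ≤ 2 * n → QC ω (γ a) (γ b) := hcomm
  have hgt : ∀ a b, 1 ≤ a → a < b → b ≤ 2 * n → QC ω⁻¹ (γ b) (γ a) :=
    fun a b h1 h2 h3 => (hlt a b h1 h2 h3).symm hω0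
  have hL : ∀ i a, 1 ≤ i → i + 1 ≤ 2 * n → 1 ≤ a → a ≤ 2 * n →
      QC (if a = i ∨ a = i + 1 then ω else 1) (Λ i) (γ a) := by
    intro i a hi hi' ha ha'
    rw [hΛ i hi hi']
    apply QC.smul_left
    obtain ⟨u1, u2⟩ := hunit (i + 1) (by omega) hi'
    rcases lt_trichotomy a i with h | h | h
    · rw [if_neg (by omega)]
      simpa [hω0] using (hgt a i ha h (by omega)).mul_left
        ((hgt a (i + 1) ha (by omega) hi').inv_left (inv_ne_zero hω0) u1 u2)
    · subst h
      rw [if_pos (by omega)]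
      simpa [hω0] using (hself a).mul_left
        ((hgt a (a + 1) ha (by omega) hi').inv_left (inv_ne_zero hω0) u1 u2)
    · by_cases h2 : a = i + 1
      · subst h2
        rw [if_pos (by omega)]
        simpa [hω0] using (hlt i (i + 1) hi (by omega) hi').mul_left
          ((hself (i + 1)).inv_left one_ne_zero u1 u2)
      · rw [if_neg (by omega)]
        simpa [hω0] using (hlt i a hi (by omega) ha').mul_left
          ((hlt (i + 1) a (by omega) (by omega) ha').inv_left hω0 u1 u2)
  have hPk : ∀ k, k ≤ n → ∀ a, 1 ≤ a → a ≤ 2 * n →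
      QC (if a ≤ 2 * k then ω else 1) (((List.range k).map (fun i => Λ (2 * i + 1)))).prod (γ a) := by
    intro k
    induction k with
    | zero =>
      intro _ a ha _
      rw [if_neg (by omega)]
      simp [QC]
    | succ k ih =>
      intro hk a ha ha'
      have h1 := (ih (by omega) a ha ha').mul_left (hL (2 * k + 1) a (by omega) (by omega) ha ha')
      rw [List.range_succ, List.map_append, List.prod_append, List.map_singleton,
        List.prod_singleton]
      convert h1 using 1
      by_cases c1 : a ≤ 2 * k
      · rw [if_pos (by omega), if_pos c1, if_neg (by omega), mul_one]
      · by_cases c2 : a = 2 * k + 1 ∨ a = 2 * k + 1 + 1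
        · rw [if_pos (by omega), if_neg c1, if_pos c2, one_mul]
        · rw [if_neg (by omega), if_neg c1, if_neg c2, one_mul]
  have hPg : ∀ a, 1 ≤ a → a ≤ 2 * n → QC ω P (γ a) := by
    intro a ha ha'
    have := hPk n le_rfl a ha ha'
    rwa [if_pos ha', ← hP] at this
  intro j hj hj'
  obtain ⟨u1, u2⟩ := hunit (j + 1) (by omega) hj'
  have hc : QC 1 P (Λ j) := by
    rw [hΛ j hj hj']
    apply QC.smul_right
    simpa [hω0] using (hPg j hj (by omega)).mul_right
      ((hPg (j + 1) (by omega) hj').inv_right hω0 u1 u2)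
  have hc' : Commute P (Λ j) := by
    have h : P * Λ j = Λ j * P := by simpa [QC] using hc
    exact h
  rw [hU j hj hj']
  exact (Commute.sum_right _ _ _ fun m _ => (hc'.pow_right m).smul_right _).smul_right _
end
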